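/- arXiv:2508.18938 — 2 statements merged into one kernel-verified Lean document; each statement's English description precedes it below -/
import Mathlib

section
/- Let p be a prime, let e ≥ 1 be an integer and set d = (e+1)!·p + 1. Let r_1,…,r_e be non-negative integers with r_1 + 2r_2 + ⋯ + e·r_e = e + 1. Then p divides the integer binom(d, r_e) · binom(d − r_e, r_{e−1}) · ⋯ · binom(d − (r_e + ⋯ + r_2), r_1). -/
/-- The binomial coefficient choosing all the parts at once divides the product of the binomial
coefficients choosing the parts successively. -/
theorem choose_sum_dvd_prod_choose (r : ℕ → ℕ) (e d : ℕ) :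
    d.choose (∑ i ∈ Finset.Icc 1 e, r i) ∣
      ∏ i ∈ Finset.Icc 1 e, (d - ∑ j ∈ Finset.Icc (i + 1) e, r j).choose (r i) := by
  induction e generalizing d with
  | zero => simp
  | succ e ih =>
    rw [Finset.prod_Icc_succ_top (by omega), Finset.sum_Icc_succ_top (by omega)]
    have hprod : ∏ i ∈ Finset.Icc 1 e,
          (d - ∑ j ∈ Finset.Icc (i + 1) (e + 1), r j).choose (r i) =
        ∏ i ∈ Finset.Icc 1 e,
          (d - r (e + 1) - ∑ j ∈ Finset.Icc (i + 1) e, r j).choose (r i) := by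
      refine Finset.prod_congr rfl fun i hi => ?_
      rw [Finset.mem_Icc] at hi
      rw [Finset.sum_Icc_succ_top (by omega), Nat.sub_sub, add_comm (r (e + 1))]
    have hmul := Nat.choose_mul (n := d)
      (k := ∑ i ∈ Finset.Icc 1 e, r i + r (e + 1)) (s := r (e + 1)) (by omega)
    rw [Nat.add_sub_cancel] at hmul
    rw [hprod, Finset.Icc_eq_empty (by omega : ¬ e + 1 + 1 ≤ e + 1), Finset.sum_empty,
      Nat.sub_zero, mul_comm]
    exact (Dvd.intro _ hmul).trans (mul_dvd_mul_left _ (ih _))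

/-- If `k !` divides `a` and `2 ≤ k`, then `p` divides `(a * p + 1).choose k`. -/
theorem dvd_choose_mul_add_one {a p k : ℕ} (hk : 2 ≤ k) (ha : k.factorial ∣ a) :
    p ∣ (a * p + 1).choose k := by
  obtain ⟨k, rfl⟩ := Nat.exists_eq_add_of_le' hk
  have hdesc : a * p ∣ (a * p).descFactorial (k + 1) := by
    rcases a * p with _ | m
    · simp
    · exact Dvd.intro _ (Nat.succ_descFactorial_succ m k).symm
  refine Nat.dvd_of_mul_dvd_mul_left (Nat.factorial_pos (k + 2)) ?_
  rw [← Nat.descFactorial_eq_factorial_mul_choose, Nat.succ_descFactorial_succ]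
  exact ((mul_dvd_mul_right ha p).trans hdesc).mul_left _

theorem divisibility_of_binomial_product
    (p : ℕ) (hp : p.Prime) (e : ℕ) (he : 1 ≤ e)
    (d : ℕ) (hd : d = Nat.factorial (e + 1) * p + 1)
    (r : ℕ → ℕ) (hr : ∑ i ∈ Finset.Icc 1 e, i * r i = e + 1) :
    p ∣ ∏ i ∈ Finset.Icc 1 e,
        Nat.choose (d - ∑ j ∈ Finset.Icc (i + 1) e, r j) (r i) := by
  have hle : ∑ i ∈ Finset.Icc 1 e, r i ≤ e + 1 := by
    rw [← hr]
    exact Finset.sum_le_sum fun i hi => Nat.le_mul_of_pos_left _ (Finset.mem_Icc.mp hi).1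
  have hge : e + 1 ≤ e * ∑ i ∈ Finset.Icc 1 e, r i := by
    rw [← hr, Finset.mul_sum]
    exact Finset.sum_le_sum fun i hi => Nat.mul_le_mul_right _ (Finset.mem_Icc.mp hi).2
  have htwo : 2 ≤ ∑ i ∈ Finset.Icc 1 e, r i := by
    by_contra! h
    have := Nat.mul_le_mul_left e (Nat.le_of_lt_succ h)
    omega
  subst hd
  exact (dvd_choose_mul_add_one htwo (Nat.factorial_dvd_factorial hle)).trans
    (choose_sum_dvd_prod_choose r e _)
end

section
/- With the notation of the context and assuming Hypothesis (H), for any α ∈ 𝕋 and any pair Q = (Q_1, Q_2) of non-positive integers one has N_2^{(0)}(Q_2; α) ≤ q^{−d_1 Q_1 n} · q^{−(d_2−1) Q_2 n} · N_1^{(d_1)}(Q; α). -/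
noncomputable section
open scoped BigOperators Classical

/-- `𝕂_∞ = 𝔽_q((u^{−1}))`, modelled as formal Laurent series in `t = u⁻¹`. -/
abbrev Kinf (Fq : Type) [Field Fq] := LaurentSeries Fq

variable (Fq : Type) [Field Fq] [Fintype Fq]

/-- The embedding `𝔽_q[u] → 𝕂_∞`, sending `u` to the Hahn series `t^{-1}`. -/
def polyEmb (f : Polynomial Fq) : Kinf Fq :=
  Polynomial.eval₂ HahnSeries.C (HahnSeries.single (-1 : ℤ) (1 : Fq)) f

/-- The absolute value `|α| = q^{ord α}` on `𝕂_∞`; in terms of the Hahn series order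
in the variable `t = u⁻¹`, `ord α = -α.order`. -/
def abv (α : Kinf Fq) : ℝ :=
  if α = 0 then 0 else (Fintype.card Fq : ℝ) ^ (-α.order)

/-- The fractional part `{α}`, keeping the coefficients of `u^i` for `i ≤ -1`. -/
def fract (α : Kinf Fq) : Kinf Fq :=
  { coeff := fun j => if 1 ≤ j then α.coeff j else 0,
    isPWO_support' := α.isPWO_support.mono (by
      intro j hj
      simp only [Function.mem_support] at hj ⊢
      by_cases h : (1:ℤ) ≤ j
      · simpa [h] using hj
      · simp [h] at hj) }

/-- `‖α‖ = |{α}|`, the distance from `α` to `𝔽_q[u]`. -/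
def fnorm (α : Kinf Fq) : ℝ := abv Fq (fract Fq α)

/-- The unit interval `𝕋 = {α : |α| < 1}`. -/
def TT : Set (Kinf Fq) := {α | abv Fq α < 1}

/-- The additive character `ψ(α) = exp(2πi·tr(a_{−1})/p)`, where `a_{−1}` is the
coefficient of `u^{−1}` in `α` and `tr : 𝔽_q → 𝔽_p` is the trace map. -/
def psi (α : Kinf Fq) : ℂ :=
  letI := ZMod.algebra Fq (ringChar Fq)
  Complex.exp (2 * Real.pi * Complex.I *
    ((Algebra.trace (ZMod (ringChar Fq)) Fq (α.coeff 1)).val : ℂ) / (ringChar Fq))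

/-!
STATEMENT 9: Under Hypothesis (H), for any α ∈ 𝕋 and non-positive integers
Q = (Q_1,Q_2), one has
N_2^{(0)}(Q_2;α) ≤ q^{−d_1Q_1n} · q^{−(d_2−1)Q_2n} · N_1^{(d_1)}(Q;α).
Hypothesis (H): G(x;y) = C_0·Γ_f(x,…,x,y,…,y) for some C_0 ∈ 𝔽_q^* and a non-singular
form f of degree d = d_1 + d_2 with symmetric coefficients c, so that
Γ_G(x̲;y̲) = C_0·Γ_f(x_1,…,x_{d_1},y_1,…,y_{d_2}).
-/

/-- The form `f(x) = Σ c_{i_1,…,i_d} x_{i_1}⋯x_{i_d}`. -/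
def formOf (n d : ℕ) (Fq' : Type) [Field Fq'] (c : (Fin d → Fin n) → Fq') :
    MvPolynomial (Fin n) Fq' :=
  ∑ i : Fin d → Fin n, MvPolynomial.C (c i) * ∏ k, MvPolynomial.X (i k)

/-- Under Hypothesis (H), the value of the multilinear form `Γ_G` at a `d`-tuple of
vectors over `𝔽_q[u]` (the first `d_1` from the x-group, the last `d_2` from the
y-group): `C_0 · Γ_f(v_1,…,v_d)`. -/
def gammaH (n d : ℕ) (C0 : Fq) (c : (Fin d → Fin n) → Fq)
    (v : Fin d → Fin n → Polynomial Fq) : Kinf Fq :=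
  (HahnSeries.C C0 : Kinf Fq) *
    ∑ i : Fin d → Fin n, (HahnSeries.C (c i) : Kinf Fq) * ∏ k, polyEmb Fq (v k (i k))

section LaurentCoefficients

variable {K : Type} [Field K]

theorem polyEmb_add (f g : Polynomial K) : polyEmb K (f + g) = polyEmb K f + polyEmb K g :=
  Polynomial.eval₂_add _ _

theorem polyEmb_C_mul (r : K) (f : Polynomial K) :
    polyEmb K (Polynomial.C r * f) = HahnSeries.C r * polyEmb K f := by
  simp [polyEmb, Polynomial.eval₂_mul]

theorem polyEmb_zero : polyEmb K 0 = 0 := Polynomial.eval₂_zero _ _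

theorem polyEmb_one : polyEmb K 1 = 1 := by
  simp [polyEmb]

theorem coeff_polyEmb (f : Polynomial K) (j : ℤ) :
    (polyEmb K f).coeff j = if j ≤ 0 then f.coeff (-j).toNat else 0 := by
  induction f using Polynomial.induction_on' with
  | add f g hf hg =>
    rw [polyEmb_add, HahnSeries.coeff_add, hf, hg]
    split_ifs <;> simp
  | monomial m r =>
    have h : polyEmb K (Polynomial.monomial m r) = HahnSeries.single (-(m : ℤ)) r := by
      simp [polyEmb, Polynomial.eval₂_monomial, HahnSeries.single_pow, HahnSeries.C_apply]
    rw [h, HahnSeries.coeff_single, Polynomial.coeff_monomial]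
    split_ifs <;> first | rfl | omega

theorem coeff_mul_of_coeff_eq_zero {x y : Kinf K} {r s : ℤ}
    (hx : ∀ j < r, x.coeff j = 0) (hy : ∀ j < s, y.coeff j = 0) :
    (x * y).coeff (r + s) = x.coeff r * y.coeff s := by
  rw [HahnSeries.coeff_mul]
  refine (Finset.sum_eq_single (r, s) ?_ ?_).trans rfl
  · rintro ⟨i, j⟩ hij hne
    rw [Finset.mem_antidiagonal] at hij
    obtain ⟨-, -, hsum⟩ := hij
    simp only at hsum ⊢
    rcases lt_trichotomy i r with h | h | h
    · rw [hx i h, zero_mul]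
    · exact absurd (Prod.ext h (by simp only; omega)) hne
    · rw [hy j (by omega), mul_zero]
  · intro h
    simp only [Finset.mem_antidiagonal, HahnSeries.mem_support, not_and_or, not_not] at h
    rcases h with h | h | h
    · rw [h, zero_mul]
    · rw [h, mul_zero]
    · exact absurd trivial h

theorem coeff_mul_eq_zero_of_pos {x y : Kinf K}
    (hx : ∀ j, 0 < j → x.coeff j = 0) (hy : ∀ j, 0 < j → y.coeff j = 0) {s : ℤ} (hs : 0 < s) :
    (x * y).coeff s = 0 := by
  rw [HahnSeries.coeff_mul]
  refine Finset.sum_eq_zero ?_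
  rintro ⟨i, j⟩ hij
  rw [Finset.mem_antidiagonal] at hij
  obtain ⟨-, -, hsum⟩ := hij
  simp only at hsum ⊢
  by_cases h : 0 < i
  · rw [hx i h, zero_mul]
  · rw [hy j (by omega), mul_zero]

/-- The coefficient of a product of a polynomial with a Laurent series whose fractional part is
small is governed by the leading terms. -/
theorem coeff_polyEmb_mul {f : Polynomial K} {x : Kinf K} {a b : ℤ} (hb : 0 ≤ b)
    (hab : a ≤ b + 1) (hf : ∀ j ≤ -a, (polyEmb K f).coeff j = 0)
    (hx : ∀ j, 1 ≤ j → j ≤ b → x.coeff j = 0) :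
    (polyEmb K f * x).coeff (-a + 1 + (b + 1)) =
      (polyEmb K f).coeff (-a + 1) * x.coeff (b + 1) := by
  have hsplit : polyEmb K f * x =
      polyEmb K f * fract K x + polyEmb K f * (x - fract K x) := by ring
  rw [hsplit, HahnSeries.coeff_add,
    coeff_mul_eq_zero_of_pos (x := polyEmb K f) (y := x - fract K x), add_zero,
    coeff_mul_of_coeff_eq_zero]
  · congr 1
    simp [fract, show (1 : ℤ) ≤ b + 1 by omega]
  · intro j hj
    exact hf j (by omega)
  · intro j hj
    by_cases h1 : 1 ≤ j <;> simp [fract, h1]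
    exact hx j h1 (by omega)
  · intro j hj
    rw [coeff_polyEmb, if_neg (by omega)]
  · intro j hj
    simp [fract, show 1 ≤ j by omega]
  · omega

theorem finite_setOf_coeff_polyEmb_eq_zero [Finite K] (a : ℤ) :
    {f : Polynomial K | ∀ j ≤ -a, (polyEmb K f).coeff j = 0}.Finite := by
  refine Set.Finite.of_injOn (f := fun f (m : Fin a.toNat) => f.coeff m) (t := Set.univ)
    (fun _ _ => Set.mem_univ _) ?_ Set.finite_univ
  intro f hf g hg hfg
  ext m
  by_cases hm : m < a.toNat
  · exact congrFun hfg ⟨m, hm⟩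
  · have hz : ∀ f : Polynomial K, (∀ j ≤ -a, (polyEmb K f).coeff j = 0) → f.coeff m = 0 := by
      intro f hf
      have := hf (-m) (by omega)
      rw [coeff_polyEmb, if_pos (by omega)] at this
      simpa using this
    rw [hz f hf, hz g hg]

theorem abv_lt_iff {Fq : Type} [Field Fq] [Fintype Fq] (x : Kinf Fq) (z : ℤ) :
    abv Fq x < (Fintype.card Fq : ℝ) ^ z ↔ ∀ j ≤ -z, x.coeff j = 0 := by
  have hq : (1 : ℝ) < Fintype.card Fq := by exact_mod_cast Fintype.one_lt_card
  unfold abv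
  split_ifs with hx
  · simp only [hx, HahnSeries.coeff_zero, implies_true, iff_true]
    positivity
  · rw [zpow_lt_zpow_iff_right₀ hq]
    constructor
    · intro h j hj
      exact HahnSeries.coeff_eq_zero_of_lt_order (by omega)
    · intro h
      by_contra! hc
      exact hx (HahnSeries.coeff_order_eq_zero.mp (h _ (by omega)))

theorem fnorm_lt_iff {Fq : Type} [Field Fq] [Fintype Fq] (x : Kinf Fq) (z : ℤ) :
    fnorm Fq x < (Fintype.card Fq : ℝ) ^ z ↔ ∀ j, 1 ≤ j → j ≤ -z → x.coeff j = 0 := by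
  rw [fnorm, abv_lt_iff]
  constructor
  · intro h j h1 hj
    simpa [fract, h1] using h j hj
  · intro h j hj
    by_cases h1 : 1 ≤ j <;> simp [fract, h1]
    exact h j h1 hj

end LaurentCoefficients

section Isotropic

variable {F : Type*} [Field F] {ι : Type*} [Fintype ι]

/-- The standard symplectic form on `F^ι × F^ι`. -/
def stdSymplecticForm (F : Type*) [Field F] (ι : Type*) [Fintype ι] :
    LinearMap.BilinForm F ((ι → F) × (ι → F)) :=
  LinearMap.mk₂ F (fun x y => x.1 ⬝ᵥ y.2 - x.2 ⬝ᵥ y.1)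
    (by intros; simp [add_dotProduct]; ring) (by intros; simp [smul_dotProduct]; ring)
    (by intros; simp [dotProduct_add]; ring) (by intros; simp [dotProduct_smul]; ring)

theorem stdSymplecticForm_apply (x y : (ι → F) × (ι → F)) :
    stdSymplecticForm F ι x y = x.1 ⬝ᵥ y.2 - x.2 ⬝ᵥ y.1 := rfl

theorem stdSymplecticForm_isAlt : (stdSymplecticForm F ι).IsAlt := fun x => by
  rw [stdSymplecticForm_apply, dotProduct_comm, sub_self]

theorem stdSymplecticForm_nondegenerate : (stdSymplecticForm F ι).Nondegenerate := by
  refine (LinearMap.IsRefl.nondegenerate_iff_separatingLeft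
    fun x y h => stdSymplecticForm_isAlt.isRefl x y h).mpr ?_
  intro x hx
  have h1 : ∀ i, x.1 i = 0 := fun i => by
    simpa [stdSymplecticForm_apply] using hx (0, Pi.single i 1)
  have h2 : ∀ i, x.2 i = 0 := fun i => by
    simpa [stdSymplecticForm_apply] using hx (Pi.single i 1, 0)
  exact Prod.ext (funext h1) (funext h2)

theorem finrank_le_card_of_isotropic (W : Submodule F ((ι → F) × (ι → F)))
    (hW : ∀ x ∈ W, ∀ y ∈ W, stdSymplecticForm F ι x y = 0) :
    Module.finrank F W ≤ Fintype.card ι := by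
  have h := LinearMap.BilinForm.finrank_orthogonal
    (stdSymplecticForm_nondegenerate (F := F) (ι := ι)) W
  have hle : Module.finrank F W ≤ Module.finrank F ((stdSymplecticForm F ι).orthogonal W) :=
    Submodule.finrank_mono fun x hx y hy => hW y hy x hx
  have hfull : Module.finrank F ((ι → F) × (ι → F)) = Fintype.card ι + Fintype.card ι := by
    rw [Module.finrank_prod, Module.finrank_fintype_fun_eq_card]
  omega

end Isotropic

section Shrinking

variable {K : Type} [Field K] {ι : Type*} [Fintype ι]

/-- The `K`-linear map `v ↦ M v` from polynomial vectors to vectors of Laurent series. -/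
def mulPolyVec (M : Matrix ι ι (Kinf K)) : (ι → Polynomial K) →ₗ[K] ι → Kinf K where
  toFun v i := ∑ k, M i k * polyEmb K (v k)
  map_add' v w := by
    ext1 i
    simp [polyEmb_add, mul_add, Finset.sum_add_distrib]
  map_smul' r v := by
    ext1 i
    simp only [Pi.smul_apply, Polynomial.smul_eq_C_mul, polyEmb_C_mul, RingHom.id_apply,
      ← HahnSeries.C_mul_eq_smul, Finset.mul_sum]
    exact Finset.sum_congr rfl fun k _ => by ring

theorem mulPolyVec_apply (M : Matrix ι ι (Kinf K)) (v : ι → Polynomial K) (i : ι) :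
    mulPolyVec M v i = ∑ k, M i k * polyEmb K (v k) := rfl

/-- The polynomial vectors `v` with `|v| < q^a` and `‖M v‖ < q^{-b}`. -/
def smallVectors (M : Matrix ι ι (Kinf K)) (a b : ℤ) : Submodule K (ι → Polynomial K) where
  carrier := {v | (∀ i, ∀ j ≤ -a, (polyEmb K (v i)).coeff j = 0) ∧
    ∀ i j, 1 ≤ j → j ≤ b → (mulPolyVec M v i).coeff j = 0}
  zero_mem' := by simp [polyEmb_zero]
  add_mem' := by
    rintro v w ⟨hv, hv'⟩ ⟨hw, hw'⟩
    refine ⟨fun i j hj => ?_, fun i j h1 hj => ?_⟩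
    · simp [polyEmb_add, hv i j hj, hw i j hj]
    · simp [hv' i j h1 hj, hw' i j h1 hj]
  smul_mem' := by
    rintro r v ⟨hv, hv'⟩
    refine ⟨fun i j hj => ?_, fun i j h1 hj => ?_⟩
    · simp [Polynomial.smul_eq_C_mul, polyEmb_C_mul, hv i j hj]
    · simp [hv' i j h1 hj]

theorem mem_smallVectors {M : Matrix ι ι (Kinf K)} {a b : ℤ} {v : ι → Polynomial K} :
    v ∈ smallVectors M a b ↔ (∀ i, ∀ j ≤ -a, (polyEmb K (v i)).coeff j = 0) ∧
      ∀ i j, 1 ≤ j → j ≤ b → (mulPolyVec M v i).coeff j = 0 := Iff.rfl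

/-- The leading coefficients of `v` and of the fractional part of `M v`. -/
def leadingCoeffs (M : Matrix ι ι (Kinf K)) (a b : ℤ) :
    (ι → Polynomial K) →ₗ[K] (ι → K) × (ι → K) where
  toFun v := (fun i => (polyEmb K (v i)).coeff (-a + 1), fun i => (mulPolyVec M v i).coeff (b + 1))
  map_add' v w := by
    ext <;> simp [polyEmb_add]
  map_smul' r v := by
    ext <;> simp [Polynomial.smul_eq_C_mul, polyEmb_C_mul]

theorem leadingCoeffs_isotropic {M : Matrix ι ι (Kinf K)} (hM : M.IsSymm) {a b : ℤ}
    (hb : 0 ≤ b) (hab : a ≤ b + 1) {v w : ι → Polynomial K}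
    (hv : v ∈ smallVectors M a b) (hw : w ∈ smallVectors M a b) :
    stdSymplecticForm K ι (leadingCoeffs M a b v) (leadingCoeffs M a b w) = 0 := by
  have key : ∀ v ∈ smallVectors M a b, ∀ w ∈ smallVectors M a b,
      (leadingCoeffs M a b v).1 ⬝ᵥ (leadingCoeffs M a b w).2 =
        (∑ i, polyEmb K (v i) * mulPolyVec M w i).coeff (-a + 1 + (b + 1)) := by
    intro v hv w hw
    rw [HahnSeries.coeff_sum]
    exact Finset.sum_congr rfl fun i _ => (coeff_polyEmb_mul hb hab (hv.1 i) (hw.2 i)).symm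
  rw [stdSymplecticForm_apply, key v hv w hw, dotProduct_comm, key w hw v hv, sub_eq_zero]
  congr 1
  simp only [mulPolyVec_apply, Finset.mul_sum]
  rw [Finset.sum_comm]
  refine Finset.sum_congr rfl fun i _ => Finset.sum_congr rfl fun k _ => ?_
  rw [hM.apply]
  ring

theorem finite_smallVectors [Finite K] (M : Matrix ι ι (Kinf K)) (a b : ℤ) :
    (smallVectors M a b : Set (ι → Polynomial K)).Finite :=
  (Set.Finite.pi' fun _ => finite_setOf_coeff_polyEmb_eq_zero a).subset fun _ hv => hv.1

/-- One step of Davenport's shrinking argument. -/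
theorem ncard_smallVectors_le [Finite K] {M : Matrix ι ι (Kinf K)} (hM : M.IsSymm)
    {a b : ℤ} (hb : 0 ≤ b) (hab : a ≤ b + 1) :
    (smallVectors M a b : Set (ι → Polynomial K)).ncard ≤ Nat.card K ^ Fintype.card ι *
      (smallVectors M (a - 1) (b + 1) : Set (ι → Polynomial K)).ncard := by
  set V := smallVectors M a b
  set φ := (leadingCoeffs M a b).domRestrict V
  have : Finite V := finite_smallVectors M a b
  have hcard : Nat.card V = Nat.card φ.ker * Nat.card φ.range := by
    rw [Submodule.card_eq_card_quotient_mul_card φ.ker,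
      Nat.card_congr φ.quotKerEquivRange.toEquiv]
  have hrange : Nat.card φ.range ≤ Nat.card K ^ Fintype.card ι := by
    rw [Module.natCard_eq_pow_finrank (K := K)]
    refine Nat.pow_le_pow_right Nat.card_pos (finrank_le_card_of_isotropic _ ?_)
    rintro _ ⟨v, rfl⟩ _ ⟨w, rfl⟩
    exact leadingCoeffs_isotropic hM hb hab v.2 w.2
  have hker : Nat.card φ.ker ≤
      (smallVectors M (a - 1) (b + 1) : Set (ι → Polynomial K)).ncard := by
    have : Finite (smallVectors M (a - 1) (b + 1)) := finite_smallVectors M _ _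
    refine Nat.card_le_card_of_injective
      (fun v : φ.ker => (⟨v.1.1, ?_⟩ : smallVectors M (a - 1) (b + 1))) ?_
    · have hv : leadingCoeffs M a b v.1.1 = 0 := v.2
      obtain ⟨h1, h2⟩ := v.1.2
      refine ⟨fun i j hj => ?_, fun i j hj1 hj => ?_⟩
      · rcases eq_or_ne j (-a + 1) with rfl | hne
        · exact congrFun (congrArg Prod.fst hv) i
        · exact h1 i j (by omega)
      · rcases eq_or_ne j (b + 1) with rfl | hne
        · exact congrFun (congrArg Prod.snd hv) i
        · exact h2 i j hj1 (by omega)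
    · intro v w h
      exact Subtype.ext (Subtype.ext (Subtype.mk.inj h))
  calc (V : Set (ι → Polynomial K)).ncard = Nat.card φ.ker * Nat.card φ.range := hcard
    _ ≤ _ := by rw [mul_comm]; exact Nat.mul_le_mul hrange hker

variable {κ : Type*} [Fintype κ]

/-- The tuples `w` of polynomial vectors with `|w_k| < q^{a_k}` for all `k` and
`‖Φ(w)‖ < q^{-b}`. -/
def smallTuples (Φ : (κ → ι → Polynomial K) → ι → Kinf K) (a : κ → ℤ) (b : ℤ) :
    Set (κ → ι → Polynomial K) :=
  {w | (∀ k i, ∀ j ≤ -a k, (polyEmb K (w k i)).coeff j = 0) ∧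
    ∀ i j, 1 ≤ j → j ≤ b → (Φ w i).coeff j = 0}

theorem finite_smallTuples [Finite K] (Φ : (κ → ι → Polynomial K) → ι → Kinf K) (a : κ → ℤ)
    (b : ℤ) : (smallTuples Φ a b).Finite :=
  (Set.Finite.pi' fun k => Set.Finite.pi' fun _ =>
    finite_setOf_coeff_polyEmb_eq_zero (a k)).subset fun _ hw => hw.1

variable [DecidableEq κ]

/-- `Φ` is linear in each of its arguments, with a symmetric matrix. -/
def IsSymmMultilinear (Φ : (κ → ι → Polynomial K) → ι → Kinf K) : Prop :=
  ∀ k w, ∃ M : Matrix ι ι (Kinf K), M.IsSymm ∧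
    ∀ v, Φ (Function.update w k v) = mulPolyVec M v

theorem ncard_smallTuples_le_of_step [Finite K] {Φ : (κ → ι → Polynomial K) → ι → Kinf K}
    (hΦ : IsSymmMultilinear Φ) {a : κ → ℤ} {b : ℤ} (hb : 0 ≤ b) {k : κ} (hab : a k ≤ b + 1) :
    (smallTuples Φ a b).ncard ≤ Nat.card K ^ Fintype.card ι *
      (smallTuples Φ (Function.update a k (a k - 1)) (b + 1)).ncard := by
  set a' := Function.update a k (a k - 1)
  have ha'k : a' k = a k - 1 := Function.update_self ..
  have ha'l : ∀ l, l ≠ k → a' l = a l := fun l hl => Function.update_of_ne hl ..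
  have hfin := finite_smallTuples Φ a b
  have hfin' := finite_smallTuples Φ a' (b + 1)
  have hsub : smallTuples Φ a' (b + 1) ⊆ smallTuples Φ a b := by
    rintro w ⟨h1, h2⟩
    refine ⟨fun l i j hj => h1 l i j ?_, fun i j hj1 hj => h2 i j hj1 (by omega)⟩
    rcases eq_or_ne l k with rfl | hl
    · omega
    · rwa [ha'l l hl]
  let r : (κ → ι → Polynomial K) → κ → ι → Polynomial K := fun w => Function.update w k 0
  have hfiber : ∀ y ∈ hfin.toFinset.image r, ∃ M : Matrix ι ι (Kinf K), M.IsSymm ∧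
      (∀ v, Function.update y k v ∈ smallTuples Φ a b ↔ v ∈ smallVectors M (a k) b) ∧
      ∀ v, Function.update y k v ∈ smallTuples Φ a' (b + 1) ↔
        v ∈ smallVectors M (a k - 1) (b + 1) := by
    intro y hy
    obtain ⟨w, hw, rfl⟩ := Finset.mem_image.mp hy
    obtain ⟨M, hM, hMv⟩ := hΦ k (r w)
    have aux : ∀ (a'' : κ → ℤ) (b' : ℤ), (∀ l, l ≠ k → a'' l = a l) → ∀ v,
        Function.update (r w) k v ∈ smallTuples Φ a'' b' ↔ v ∈ smallVectors M (a'' k) b' := by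
      intro a'' b' ha'' v
      rw [smallTuples, Set.mem_ofPred_eq, hMv, mem_smallVectors]
      refine and_congr_left fun _ => ⟨fun h i j hj => by simpa using h k i j hj,
        fun h l i j hj => ?_⟩
      rcases eq_or_ne l k with rfl | hl
      · simpa using h i j hj
      · simp only [r, Function.update_of_ne hl]
        exact (hfin.mem_toFinset.mp hw).1 l i j (by rwa [← ha'' l hl])
    refine ⟨M, hM, aux a b fun _ _ => rfl, ?_⟩
    rw [← ha'k]
    exact aux a' (b + 1) ha'l
  have hcount : ∀ {S : Set (κ → ι → Polynomial K)} (hS : S.Finite) (y : κ → ι → Polynomial K)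
      (_ : y ∈ hfin.toFinset.image r) (W : Submodule K (ι → Polynomial K)),
      (∀ v, Function.update y k v ∈ S ↔ v ∈ W) →
      (hS.toFinset.filter (fun w => r w = y)).card = (W : Set (ι → Polynomial K)).ncard := by
    intro S hS y hy W hW
    rw [← Set.ncard_image_of_injective _ (Function.update_injective y k), ← Set.ncard_coe_finset]
    congr 1
    ext w
    simp only [Finset.coe_filter, Set.Finite.mem_toFinset, Set.mem_ofPred_eq, Set.mem_image,
      SetLike.mem_coe, ← hW]
    constructor
    · rintro ⟨hw, rfl⟩
      exact ⟨w k, by simpa [r] using hw, by simp [r]⟩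
    · rintro ⟨v, hv, rfl⟩
      refine ⟨hv, ?_⟩
      obtain ⟨w, -, rfl⟩ := Finset.mem_image.mp hy
      simp [r]
  rw [Set.ncard_eq_toFinset_card _ hfin, Set.ncard_eq_toFinset_card _ hfin',
    Finset.card_eq_sum_card_fiberwise (f := r) (t := hfin.toFinset.image r)
      (fun w hw => Finset.mem_image_of_mem r hw),
    Finset.card_eq_sum_card_fiberwise (f := r) (s := hfin'.toFinset)
      (t := hfin.toFinset.image r)
      (fun w hw => Finset.mem_image_of_mem r
        (hfin.mem_toFinset.mpr (hsub (hfin'.mem_toFinset.mp hw)))), Finset.mul_sum]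
  refine Finset.sum_le_sum fun y hy => ?_
  obtain ⟨M, hM, h, h'⟩ := hfiber y hy
  rw [hcount hfin y hy _ h, hcount hfin' y hy _ h']
  exact ncard_smallVectors_le hM hb hab

/-- Davenport's shrinking argument applied in every argument of `Φ`. -/
theorem ncard_smallTuples_le [Finite K] {Φ : (κ → ι → Polynomial K) → ι → Kinf K}
    (hΦ : IsSymmMultilinear Φ) {a : κ → ℤ} {b : ℤ} (hb : 0 ≤ b) (hab : ∀ k, a k ≤ b)
    (z : κ → ℕ) :
    (smallTuples Φ a b).ncard ≤ (Nat.card K ^ Fintype.card ι) ^ (∑ k, z k) *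
      (smallTuples Φ (fun k => a k - z k) (b + ∑ k, (z k : ℤ))).ncard := by
  induction hs : ∑ k, z k generalizing a b z with
  | zero =>
    have hz : ∀ k, z k = 0 := by simpa using hs
    simp [hz]
  | succ s ih =>
    obtain ⟨k, -, hk⟩ : ∃ k ∈ Finset.univ, z k ≠ 0 :=
      Finset.exists_ne_zero_of_sum_ne_zero (by omega)
    let z' := Function.update z k (z k - 1)
    have hz' : ∑ l, z l = ∑ l, z' l + 1 := by
      have h1 := Finset.add_sum_erase Finset.univ z (Finset.mem_univ k)
      have h2 := Finset.add_sum_erase Finset.univ z' (Finset.mem_univ k)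
      have h3 : ∑ l ∈ Finset.univ.erase k, z' l = ∑ l ∈ Finset.univ.erase k, z l :=
        Finset.sum_congr rfl fun l hl => Function.update_of_ne (Finset.ne_of_mem_erase hl) ..
      have h4 : z' k = z k - 1 := Function.update_self ..
      omega
    have hz'' : (∑ l, (z l : ℤ)) = ∑ l, (z' l : ℤ) + 1 := by exact_mod_cast hz'
    have hstep := ncard_smallTuples_le_of_step hΦ hb ((hab k).trans (by omega))
    have hrec := ih (a := Function.update a k (a k - 1)) (b := b + 1) (by omega) (fun l => by
      rcases eq_or_ne l k with rfl | hl
      · have := hab l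
        simp only [Function.update_self]
        omega
      · have := hab l
        simp only [Function.update_of_ne hl]
        omega) z' (by omega)
    have hrad : (fun l => Function.update a k (a k - 1) l - (z' l : ℤ)) = fun l => a l - z l := by
      ext l
      rcases eq_or_ne l k with rfl | hl
      · simp only [z', Function.update_self]
        omega
      · simp [z', hl]
    rw [hrad, show b + 1 + ∑ l, (z' l : ℤ) = b + ∑ l, (z l : ℤ) by omega] at hrec
    calc _ ≤ _ := hstep
      _ ≤ _ := Nat.mul_le_mul_left _ hrec
      _ = _ := by rw [pow_succ']; ring

end Shrinking

section SymmetricForm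

variable {K : Type} [Field K] {n d : ℕ}

/-- The multilinear form over the Laurent series with coefficients `c`. -/
def polarForm (c : (Fin d → Fin n) → K) :
    MultilinearMap (Kinf K) (fun _ : Fin d => Fin n → Kinf K) (Kinf K) :=
  ∑ i : Fin d → Fin n, (HahnSeries.C (c i) : Kinf K) •
    (MultilinearMap.mkPiAlgebra (Kinf K) (Fin d) (Kinf K)).compLinearMap
      fun l => LinearMap.proj (i l)

theorem polarForm_apply (c : (Fin d → Fin n) → K) (T : Fin d → Fin n → Kinf K) :
    polarForm c T = ∑ i : Fin d → Fin n, (HahnSeries.C (c i) : Kinf K) * ∏ l, T l (i l) := by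
  simp [polarForm]

theorem polarForm_comp_perm {c : (Fin d → Fin n) → K}
    (hsym : ∀ (σ : Equiv.Perm (Fin d)) (i : Fin d → Fin n), c (i ∘ σ) = c i)
    (σ : Equiv.Perm (Fin d)) (T : Fin d → Fin n → Kinf K) :
    polarForm c (T ∘ σ) = polarForm c T := by
  rw [polarForm_apply, polarForm_apply,
    ← Equiv.sum_comp (Equiv.arrowCongr σ.symm (Equiv.refl (Fin n)))]
  refine Finset.sum_congr rfl fun i _ => ?_
  have hi : Equiv.arrowCongr σ.symm (Equiv.refl (Fin n)) i = i ∘ σ := rfl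
  rw [hi, hsym]
  congr 1
  exact Equiv.prod_comp σ fun l => T l (i l)

theorem isSymmMultilinear_gammaH {κ : Type*} [DecidableEq κ] (α : Kinf K) (C0 : K)
    {c : (Fin d → Fin n) → K}
    (hsym : ∀ (σ : Equiv.Perm (Fin d)) (i : Fin d → Fin n), c (i ∘ σ) = c i)
    (e : κ ⊕ Fin 1 ≃ Fin d) :
    IsSymmMultilinear fun (w : κ → Fin n → Polynomial K) i =>
      α * gammaH K n d C0 c (Sum.elim w (fun _ => Pi.single i 1) ∘ e.symm) := by
  intro k w
  obtain ⟨l, hl⟩ : ∃ l, e (Sum.inl k) = l := ⟨_, rfl⟩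
  obtain ⟨L, hL⟩ : ∃ L, e (Sum.inr 0) = L := ⟨_, rfl⟩
  have hlL : l ≠ L := by simp [← hl, ← hL]
  let T : Fin d → Fin n → Kinf K := fun m r =>
    polyEmb K (Sum.elim w (fun _ => 0) (e.symm m) r)
  let B : Fin n → (Fin n → Kinf K) → Kinf K := fun i x =>
    polarForm c (Function.update (Function.update T L (Pi.single i 1)) l x)
  have hB_symm : ∀ i j, B j (Pi.single i 1) = B i (Pi.single j 1) := by
    intro i j
    simp only [B]
    rw [← polarForm_comp_perm hsym (Equiv.swap l L)]
    refine congrArg (polarForm c) (funext fun m => ?_)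
    rcases eq_or_ne m l with rfl | hml
    · simp [hlL.symm]
    rcases eq_or_ne m L with rfl | hmL
    · simp [hlL.symm]
    · simp [Equiv.swap_apply_of_ne_of_ne hml hmL, hml, hmL]
  refine ⟨Matrix.of fun i j => α * (HahnSeries.C C0 * B i (Pi.single j 1)),
    Matrix.IsSymm.ext fun i j => by simp only [Matrix.of_apply, hB_symm i j], fun v => ?_⟩
  · ext1 i
    have hγ : gammaH K n d C0 c
        (Sum.elim (Function.update w k v) (fun _ => Pi.single i 1) ∘ e.symm) =
          HahnSeries.C C0 * B i fun j => polyEmb K (v j) := by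
      simp only [gammaH, B]
      rw [polarForm_apply]
      congr 1
      refine Finset.sum_congr rfl fun idx _ => ?_
      congr 1
      refine Finset.prod_congr rfl fun m _ => ?_
      obtain ⟨m, rfl⟩ := e.surjective m
      rcases m with m | m
      · have hmL : e (Sum.inl m) ≠ L := by simp [← hL]
        rcases eq_or_ne m k with rfl | hm
        · rw [hl, Function.update_self, ← hl, Function.comp_apply, e.symm_apply_apply,
            Sum.elim_inl, Function.update_self]
        · have hml : e (Sum.inl m) ≠ l := by simp [← hl, hm]
          rw [Function.update_of_ne hml, Function.update_of_ne hmL, Function.comp_apply,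
            e.symm_apply_apply, Sum.elim_inl, Function.update_of_ne hm]
          simp only [T, e.symm_apply_apply, Sum.elim_inl]
      · obtain rfl := Subsingleton.elim m 0
        rw [hL, Function.update_of_ne hlL.symm, Function.update_self, Function.comp_apply, ← hL,
          e.symm_apply_apply, Sum.elim_inr]
        by_cases h : idx (e (Sum.inr 0)) = i
        · simp [h, polyEmb_one]
        · simp [h, polyEmb_zero]
    have hB : ∀ x : Fin n → Kinf K, B i x = ∑ j, x j * B i (Pi.single j 1) := by
      intro x
      conv_lhs => rw [pi_eq_sum_univ' x]
      simp only [B, MultilinearMap.map_update_sum, MultilinearMap.map_update_smul, smul_eq_mul]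
    beta_reduce
    rw [hγ, hB, mulPolyVec_apply, Finset.mul_sum, Finset.mul_sum]
    exact Finset.sum_congr rfl fun j _ => by simp only [Matrix.of_apply]; ring

end SymmetricForm

section Slots

/-- Numbering of the arguments of a form of bidegree `(d1, d2)`, the last one singled out. -/
def slotEquiv {d d1 d2 : ℕ} (h : d1 + (d2 - 1 + 1) = d) :
    (Fin d1 ⊕ Fin (d2 - 1)) ⊕ Fin 1 ≃ Fin d :=
  (Equiv.sumAssoc _ _ _).trans <|
    ((Equiv.refl _).sumCongr finSumFinEquiv).trans <| finSumFinEquiv.trans (finCongr h)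

theorem append_snoc_comp_cast {d d1 d2 : ℕ} {β : Type*} (h : d1 + (d2 - 1 + 1) = d)
    (w : Fin d1 ⊕ Fin (d2 - 1) → β) (x : β) :
    Fin.append (fun a => w (Sum.inl a))
        (Fin.snoc (α := fun _ => β) (fun b => w (Sum.inr b)) x) ∘ Fin.cast h.symm =
      Sum.elim w (fun _ => x) ∘ (slotEquiv h).symm := by
  subst h
  rw [Equiv.eq_comp_symm]
  ext1 m
  rcases m with (a | b) | z
  · simp [slotEquiv]
  · simp only [slotEquiv, Function.comp_apply, Equiv.trans_apply, Equiv.sumAssoc_apply_inl_inr,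
      Equiv.sumCongr_apply, Sum.map_inr, finSumFinEquiv_apply_left, finSumFinEquiv_apply_right,
      finCongr_refl, Equiv.refl_apply, Fin.cast_eq_self, Fin.append_right, Sum.elim_inl]
    exact Fin.snoc_castSucc (α := fun _ => β) x (fun b => w (Sum.inr b)) b
  · obtain rfl := Subsingleton.elim z 0
    simp only [slotEquiv, Function.comp_apply, Equiv.trans_apply, Equiv.sumAssoc_apply_inr,
      Equiv.sumCongr_apply, Sum.map_inr, finSumFinEquiv_apply_right,
      finCongr_refl, Equiv.refl_apply, Fin.cast_eq_self, Fin.append_right, Sum.elim_inr]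
    exact Fin.snoc_last (α := fun _ => β) x (fun b => w (Sum.inr b))

end Slots

theorem shrinking_count_bound
    (n d d1 d2 : ℕ) (hd : d = d1 + d2) (hd2 : 1 ≤ d2) (hdd : 2 ≤ d)
    (hp : d < ringChar Fq)
    (C0 : Fq) (hC0 : C0 ≠ 0)
    (c : (Fin d → Fin n) → Fq)
    (hsym : ∀ (σ : Equiv.Perm (Fin d)) (i : Fin d → Fin n), c (i ∘ σ) = c i)
    (hns : ∀ x : Fin n → AlgebraicClosure Fq,
      (∀ i, MvPolynomial.eval x (MvPolynomial.map (algebraMap Fq (AlgebraicClosure Fq))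
        (MvPolynomial.pderiv i (formOf n d Fq c))) = 0) → x = 0)
    (P1 P2 : ℕ) (hP1 : 1 ≤ P1) (hP12 : P1 ≤ P2)
    (Q1 Q2 : ℤ) (hQ1 : Q1 ≤ 0) (hQ2 : Q2 ≤ 0)
    (α : Kinf Fq) (hα : α ∈ TT Fq) :
    (Set.ncard {p : (Fin d1 → Fin n → Polynomial Fq) ×
        (Fin (d2 - 1) → Fin n → Polynomial Fq) |
      (∀ a i, abv Fq (polyEmb Fq (p.1 a i)) < (Fintype.card Fq : ℝ) ^ (P1 : ℤ)) ∧
      (∀ b i, abv Fq (polyEmb Fq (p.2 b i)) < (Fintype.card Fq : ℝ) ^ (P2 : ℤ)) ∧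
      ∀ i : Fin n,
        fnorm Fq (α * gammaH Fq n d C0 c
            ((Fin.append p.1 (Fin.snoc p.2 (Pi.single i (1 : Polynomial Fq)))) ∘
              (Fin.cast (by omega) : Fin d → Fin (d1 + (d2 - 1 + 1))))) <
          (Fintype.card Fq : ℝ) ^ (-(P2 : ℤ))} : ℝ) ≤
    (Fintype.card Fq : ℝ) ^ (-((d1 : ℤ) * Q1 * n)) *
      (Fintype.card Fq : ℝ) ^ (-(((d2 : ℤ) - 1) * Q2 * n)) *
      (Set.ncard {p : (Fin d1 → Fin n → Polynomial Fq) ×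
          (Fin (d2 - 1) → Fin n → Polynomial Fq) |
        (∀ a i, abv Fq (polyEmb Fq (p.1 a i)) < (Fintype.card Fq : ℝ) ^ (Q1 + (P1 : ℤ))) ∧
        (∀ b i, abv Fq (polyEmb Fq (p.2 b i)) < (Fintype.card Fq : ℝ) ^ (Q2 + (P2 : ℤ))) ∧
        ∀ i : Fin n,
          fnorm Fq (α * gammaH Fq n d C0 c
              ((Fin.append p.1 (Fin.snoc p.2 (Pi.single i (1 : Polynomial Fq)))) ∘
                (Fin.cast (by omega) : Fin d → Fin (d1 + (d2 - 1 + 1))))) <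
            (Fintype.card Fq : ℝ) ^ ((d1 : ℤ) * Q1 + ((d2 : ℤ) - 1) * Q2 - P2)} : ℝ) := by
  have h : d1 + (d2 - 1 + 1) = d := by omega
  set Φ : (Fin d1 ⊕ Fin (d2 - 1) → Fin n → Polynomial Fq) → Fin n → Kinf Fq := fun w i =>
    α * gammaH Fq n d C0 c (Sum.elim w (fun _ => Pi.single i 1) ∘ (slotEquiv h).symm) with hΦ
  have hset : ∀ R1 R2 R : ℤ,
      Set.ncard {p : (Fin d1 → Fin n → Polynomial Fq) × (Fin (d2 - 1) → Fin n → Polynomial Fq) |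
        (∀ a i, abv Fq (polyEmb Fq (p.1 a i)) < (Fintype.card Fq : ℝ) ^ R1) ∧
        (∀ b i, abv Fq (polyEmb Fq (p.2 b i)) < (Fintype.card Fq : ℝ) ^ R2) ∧
        ∀ i : Fin n,
          fnorm Fq (α * gammaH Fq n d C0 c
              ((Fin.append p.1 (Fin.snoc p.2 (Pi.single i (1 : Polynomial Fq)))) ∘
                (Fin.cast h.symm))) < (Fintype.card Fq : ℝ) ^ R} =
      (smallTuples Φ (Sum.elim (fun _ => R1) fun _ => R2) (-R)).ncard := by
    intro R1 R2 R
    rw [← Set.ncard_image_of_injective _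
      (Equiv.sumArrowEquivProdArrow (Fin d1) (Fin (d2 - 1)) (Fin n → Polynomial Fq)).injective,
      Equiv.image_eq_preimage_symm]
    congr 1
    ext p
    obtain ⟨w, rfl⟩ := (Equiv.sumArrowEquivProdArrow _ _ _).surjective p
    simp only [Set.mem_ofPred_eq, Set.mem_preimage, Equiv.symm_apply_apply, smallTuples,
      abv_lt_iff, fnorm_lt_iff, Sum.forall, Sum.elim_inl, Sum.elim_inr, and_assoc]
    have hw := append_snoc_comp_cast h w
    refine and_congr Iff.rfl (and_congr Iff.rfl (forall_congr' fun i => ?_))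
    rw [hΦ]
    beta_reduce
    rw [← hw]
    rfl
  rw [hset, hset]
  obtain ⟨z1, rfl⟩ : ∃ z : ℕ, Q1 = -z := ⟨Q1.natAbs, by omega⟩
  obtain ⟨z2, rfl⟩ : ∃ z : ℕ, Q2 = -z := ⟨Q2.natAbs, by omega⟩
  have key := ncard_smallTuples_le (isSymmMultilinear_gammaH α C0 hsym (slotEquiv h))
    (a := Sum.elim (fun _ => (P1 : ℤ)) fun _ => (P2 : ℤ)) (b := -(-(P2 : ℤ))) (by omega)
    (by rintro (a | b) <;> simp [hP12])
    (Sum.elim (fun _ => z1) fun _ => z2)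
  have hrad : (fun k => (Sum.elim (fun _ => (P1 : ℤ)) (fun _ => (P2 : ℤ)) k : ℤ) -
      ((Sum.elim (fun _ => z1) (fun _ => z2) k : ℕ) : ℤ)) =
      (Sum.elim (fun _ => -(z1 : ℤ) + P1) (fun _ => -(z2 : ℤ) + P2) :
        Fin d1 ⊕ Fin (d2 - 1) → ℤ) := by
    ext (a | b) <;> simp only [Sum.elim_inl, Sum.elim_inr] <;> ring
  have hd2' : ((d2 - 1 : ℕ) : ℤ) = (d2 : ℤ) - 1 := by omega
  have hdual : -(-(P2 : ℤ)) + ∑ k : Fin d1 ⊕ Fin (d2 - 1),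
      ((Sum.elim (fun _ => z1) (fun _ => z2) k : ℕ) : ℤ) =
      -((d1 : ℤ) * -(z1 : ℤ) + ((d2 : ℤ) - 1) * -(z2 : ℤ) - P2) := by
    simp only [Fintype.sum_sum_type, Sum.elim_inl, Sum.elim_inr, Finset.sum_const,
      Finset.card_univ, Fintype.card_fin, nsmul_eq_mul, hd2']
    ring
  rw [hrad, hdual] at key
  have hq : (Fintype.card Fq : ℝ) ≠ 0 := by exact_mod_cast Fintype.card_ne_zero
  have hfactor : (Fintype.card Fq : ℝ) ^ (-((d1 : ℤ) * -(z1 : ℤ) * n)) *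
      (Fintype.card Fq : ℝ) ^ (-(((d2 : ℤ) - 1) * -(z2 : ℤ) * n)) =
      (((Nat.card Fq ^ Fintype.card (Fin n)) ^
        (∑ k : Fin d1 ⊕ Fin (d2 - 1), Sum.elim (fun _ => z1) (fun _ => z2) k) : ℕ) : ℝ) := by
    rw [← zpow_add₀ hq, Nat.card_eq_fintype_card, Fintype.card_fin, ← pow_mul, Nat.cast_pow,
      ← zpow_natCast]
    congr 1
    simp only [Fintype.sum_sum_type, Sum.elim_inl, Sum.elim_inr, Finset.sum_const,
      Finset.card_univ, Fintype.card_fin, smul_eq_mul]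
    push_cast [hd2']
    ring
  rw [hfactor]
  exact_mod_cast key
end
end
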